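/- Let M be the 3m×2m block matrix M = [[N_L, 0],[N_U, N_L],[0, N_U]] and set H = T · M (an m×2m matrix). Then for every i with 1 ≤ i ≤ m+1, B_i · H = T_i. -/

import Mathlib

open Matrix

noncomputable section

/-- Lower triangular Toeplitz m×m matrix: entry (i,j) equals `a (i-j)` (0-based),
i.e. `a_{i-j+1}` in the 1-based notation of the paper, for j ≤ i, and 0 otherwise. -/
def lowT (m : ℕ) (a : Fin (m + 1) → ℝ) : Matrix (Fin m) (Fin m) ℝ :=
  fun i j =>
    if h : (j : ℕ) ≤ (i : ℕ) then a ⟨(i : ℕ) - (j : ℕ), by have := i.2; omega⟩ else 0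

/-- Upper triangular Toeplitz m×m matrix: entry (i,j) equals `a (m + i - j)` (0-based),
i.e. `a_{m+1+i-j}` in the 1-based notation of the paper, for i ≤ j, and 0 otherwise. -/
def upT (m : ℕ) (a : Fin (m + 1) → ℝ) : Matrix (Fin m) (Fin m) ℝ :=
  fun i j =>
    if h : (i : ℕ) ≤ (j : ℕ) then a ⟨m + (i : ℕ) - (j : ℕ), by have := j.2; omega⟩ else 0

/-- The 2m×2m Sylvester matrix S = [[D_L, N_L],[D_U, N_U]]. -/
def sylv (m : ℕ) (d n : Fin (m + 1) → ℝ) : Matrix (Fin (m + m)) (Fin (m + m)) ℝ :=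
  (fromBlocks (lowT m d) (lowT m n) (upT m d) (upT m n)).submatrix
    finSumFinEquiv.symm finSumFinEquiv.symm

/-- The 2m×2m lower triangular matrix D = [[D_L, 0],[D_U, D_L]]. -/
def dMat (m : ℕ) (d : Fin (m + 1) → ℝ) : Matrix (Fin (m + m)) (Fin (m + m)) ℝ :=
  (fromBlocks (lowT m d) (0 : Matrix (Fin m) (Fin m) ℝ) (upT m d) (lowT m d)).submatrix
    finSumFinEquiv.symm finSumFinEquiv.symm

/-- The m×2m matrix formed by the last m rows of a 2m×2m matrix. -/
def lastRows (m : ℕ) (M : Matrix (Fin (m + m)) (Fin (m + m)) ℝ) :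
    Matrix (Fin m) (Fin (m + m)) ℝ :=
  fun i j => M ⟨m + (i : ℕ), by have := i.2; omega⟩ j

/-- The m×m submatrix of an m×2m matrix consisting of the m consecutive columns
starting from column i (0-based; column i+1 in the 1-based notation of the paper). -/
def subCols (m : ℕ) (M : Matrix (Fin m) (Fin (m + m)) ℝ) (i : Fin (m + 1)) :
    Matrix (Fin m) (Fin m) ℝ :=
  fun r c => M r ⟨(i : ℕ) + (c : ℕ), by have := i.2; have := c.2; omega⟩

/-- The kernel T = ( -D_U·D_L⁻¹ | I_m | -D_L·D_U⁻¹ ), an m×3m matrix. -/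
def kerT (m : ℕ) (d : Fin (m + 1) → ℝ) : Matrix (Fin m) (Fin (m + m + m)) ℝ :=
  (fromCols
      (fromCols (-(upT m d * (lowT m d)⁻¹)) (1 : Matrix (Fin m) (Fin m) ℝ))
      (-(lowT m d * (upT m d)⁻¹))).submatrix id
    (((Equiv.sumCongr finSumFinEquiv (Equiv.refl (Fin m))).trans finSumFinEquiv).symm)

/-- T_i : the m×2m submatrix of T consisting of the 2m consecutive columns
starting from column i (0-based). -/
def tSub (m : ℕ) (d : Fin (m + 1) → ℝ) (i : Fin (m + 1)) :
    Matrix (Fin m) (Fin (m + m)) ℝ :=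
  fun r c => kerT m d r ⟨(i : ℕ) + (c : ℕ), by have := i.2; have := c.2; omega⟩

/-- T_{i,j} : the m×m submatrix of T_i consisting of the m consecutive columns
starting from column j (0-based). -/
def tSub2 (m : ℕ) (d : Fin (m + 1) → ℝ) (i j : Fin (m + 1)) :
    Matrix (Fin m) (Fin m) ℝ :=
  fun r c =>
    kerT m d r ⟨(i : ℕ) + (j : ℕ) + (c : ℕ), by have := i.2; have := j.2; have := c.2; omega⟩

/-- The 2m×m block column matrix [D_L; D_U]. -/
def dlMat (m : ℕ) (d : Fin (m + 1) → ℝ) : Matrix (Fin (m + m)) (Fin m) ℝ :=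
  (fromRows (lowT m d) (upT m d)).submatrix finSumFinEquiv.symm id

/-- The 2m×m block column matrix [0; D_L]. -/
def drMat (m : ℕ) (d : Fin (m + 1) → ℝ) : Matrix (Fin (m + m)) (Fin m) ℝ :=
  (fromRows (0 : Matrix (Fin m) (Fin m) ℝ) (lowT m d)).submatrix finSumFinEquiv.symm id

/-- The 2m×m block column matrix [N_L; N_U]. -/
def nMat (m : ℕ) (n : Fin (m + 1) → ℝ) : Matrix (Fin (m + m)) (Fin m) ℝ :=
  (fromRows (lowT m n) (upT m n)).submatrix finSumFinEquiv.symm id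

/-- The 3m×2m block matrix [[X_L, 0],[X_U, X_L],[0, X_U]] built from the
lower/upper triangular Toeplitz matrices of a. -/
def kMat (m : ℕ) (a : Fin (m + 1) → ℝ) : Matrix (Fin (m + m + m)) (Fin (m + m)) ℝ :=
  (fromRows
      (fromRows (fromCols (lowT m a) (0 : Matrix (Fin m) (Fin m) ℝ))
        (fromCols (upT m a) (lowT m a)))
      (fromCols (0 : Matrix (Fin m) (Fin m) ℝ) (upT m a))).submatrix
    (((Equiv.sumCongr finSumFinEquiv (Equiv.refl (Fin m))).trans finSumFinEquiv).symm)
    finSumFinEquiv.symm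

/-- Index reversal i ↦ m - i on 0-based indices, corresponding to the 1-based
index map i ↦ m - i + 2 of the paper. -/
def revIdx (m : ℕ) (i : Fin (m + 1)) : Fin (m + 1) := ⟨m - (i : ℕ), by omega⟩

/-- The `k`-th column of a matrix, extended by zero beyond the last column. -/
def colSeq {m N : ℕ} (M : Matrix (Fin m) (Fin N) ℝ) (k : ℕ) : Fin m → ℝ :=
  fun r => if h : k < N then M r ⟨k, h⟩ else 0

theorem colSeq_apply {m N : ℕ} (M : Matrix (Fin m) (Fin N) ℝ) {k : ℕ} (h : k < N) (r : Fin m) :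
    colSeq M k r = M r ⟨k, h⟩ := dif_pos h

/-- Entry `(l, j)` of the banded Toeplitz matrix whose `j`-th column is `a` shifted down by `j`. -/
def bandEntry {m : ℕ} (a : Fin (m + 1) → ℝ) (l j : ℕ) : ℝ :=
  if h : j ≤ l ∧ l < j + (m + 1) then a ⟨l - j, by omega⟩ else 0

theorem sum_mul_bandEntry {m N : ℕ} (M : Matrix (Fin m) (Fin N) ℝ) (a : Fin (m + 1) → ℝ)
    {j : ℕ} (hj : j + m < N) (r : Fin m) :
    ∑ l : Fin N, M r l * bandEntry a l j = (∑ k : Fin (m + 1), a k • colSeq M (j + k)) r := by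
  rw [Finset.sum_apply]
  symm
  refine Finset.sum_of_injOn (fun k : Fin (m + 1) => (⟨j + k, by omega⟩ : Fin N)) ?_ ?_ ?_ ?_
  · intro x _ y _ hxy
    simp only [Fin.mk.injEq] at hxy
    exact Fin.ext (by omega)
  · intro x _
    simp
  · intro l _ hl
    have : ¬(j ≤ (l : ℕ) ∧ (l : ℕ) < j + (m + 1)) := by
      rintro ⟨h₁, h₂⟩
      exact hl ⟨⟨l - j, by omega⟩, by simp, Fin.ext (by simp; omega)⟩
    simp [bandEntry, this]
  · intro k _
    have hk : j ≤ j + (k : ℕ) ∧ j + (k : ℕ) < j + (m + 1) := by omega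
    simp only [bandEntry, dif_pos hk, Pi.smul_apply, smul_eq_mul,
      colSeq_apply M (show j + (k : ℕ) < N by omega), Nat.add_sub_cancel_left]
    exact mul_comm _ _

/-- A solution of a linear recurrence with nonzero leading coefficient that starts with `m`
zeros vanishes. -/
theorem eq_zero_of_recurrence {V : Type*} [AddCommGroup V] [Module ℝ V] {m : ℕ}
    {d : Fin (m + 1) → ℝ} (hd : d (Fin.last m) ≠ 0) {u : ℕ → V} {L : ℕ}
    (h₀ : ∀ k < m, u k = 0) (hu : ∀ j < L, ∑ k : Fin (m + 1), d k • u (j + k) = 0) :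
    ∀ k < m + L, u k = 0 := by
  intro k
  induction k using Nat.strong_induction_on with
  | _ k ih =>
    intro hk
    by_cases hkm : k < m
    · exact h₀ k hkm
    obtain ⟨j, rfl⟩ := Nat.exists_eq_add_of_le' (not_lt.mp hkm)
    have h := hu j (by omega)
    rw [Fin.sum_univ_castSucc, Finset.sum_eq_zero, zero_add] at h
    · exact (smul_eq_zero.mp h).resolve_left hd
    · intro i _
      rw [ih _ (by simp) (by simp; omega), smul_zero]

section Blocks

variable {m : ℕ}

theorem kMat_apply (a : Fin (m + 1) → ℝ) (l : Fin (m + m + m)) (j : Fin (m + m)) :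
    kMat m a l j = bandEntry a l j := by
  induction l using Fin.addCases with
  | left l =>
    induction l using Fin.addCases with
    | left l =>
      induction j using Fin.addCases with
      | left j =>
        simp [-Fin.natAdd_eq_addNat, kMat, bandEntry, lowT]
        grind
      | right j =>
        simp [-Fin.natAdd_eq_addNat, kMat, bandEntry]
        grind
    | right l =>
      induction j using Fin.addCases with
      | left j =>
        simp [-Fin.natAdd_eq_addNat, kMat, bandEntry, upT]
        grind
      | right j =>
        simp [-Fin.natAdd_eq_addNat, kMat, bandEntry, lowT]
        grind
  | right l =>
    induction j using Fin.addCases with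
    | left j =>
      simp [-Fin.natAdd_eq_addNat, kMat, bandEntry]
      grind
    | right j =>
      simp [-Fin.natAdd_eq_addNat, kMat, bandEntry, upT]
      grind

theorem sylv_apply_left (d n : Fin (m + 1) → ℝ) (l : Fin (m + m)) (j : Fin m) :
    sylv m d n l (Fin.castAdd m j) = bandEntry d l j := by
  induction l using Fin.addCases with
  | left l =>
    simp [-Fin.natAdd_eq_addNat, sylv, bandEntry, lowT]
    grind
  | right l =>
    simp [-Fin.natAdd_eq_addNat, sylv, bandEntry, upT]
    grind

theorem sylv_apply_right (d n : Fin (m + 1) → ℝ) (l : Fin (m + m)) (j : Fin m) :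
    sylv m d n l (Fin.natAdd m j) = bandEntry n l j := by
  induction l using Fin.addCases with
  | left l =>
    simp [-Fin.natAdd_eq_addNat, sylv, bandEntry, lowT]
    grind
  | right l =>
    simp [-Fin.natAdd_eq_addNat, sylv, bandEntry, upT]
    grind

theorem isUnit_det_lowT {d : Fin (m + 1) → ℝ} (hd : d 0 ≠ 0) : IsUnit (lowT m d).det := by
  rw [det_of_isLowerTriangular]
  · simp [lowT, hd]
  · intro i j hij
    have : (i : ℕ) < j := hij
    simp [lowT]
    omega

theorem isUnit_det_upT {d : Fin (m + 1) → ℝ} (hd : d (Fin.last m) ≠ 0) :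
    IsUnit (upT m d).det := by
  have hm : (⟨m, by omega⟩ : Fin (m + 1)) = Fin.last m := rfl
  rw [det_of_isUpperTriangular]
  · simp [upT, hd, hm]
  · intro i j hij
    have : (j : ℕ) < i := hij
    simp [upT]
    omega

theorem kerT_mul_kMat_self {d : Fin (m + 1) → ℝ} (h₀ : d 0 ≠ 0) (h₁ : d (Fin.last m) ≠ 0) :
    kerT m d * kMat m d = 0 := by
  have hL : (lowT m d)⁻¹ * lowT m d = 1 := nonsing_inv_mul _ (isUnit_det_lowT h₀)
  have hU : (upT m d)⁻¹ * upT m d = 1 := nonsing_inv_mul _ (isUnit_det_upT h₁)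
  rw [kerT, kMat, submatrix_mul_equiv, fromCols_mul_fromRows, fromCols_mul_fromRows,
    mul_fromCols, mul_fromCols, mul_fromCols]
  simp only [neg_mul, Matrix.mul_assoc, hL, hU, Matrix.mul_one, Matrix.one_mul, Matrix.mul_zero]
  ext i j
  induction j using Fin.addCases <;> simp [-Fin.natAdd_eq_addNat]

theorem colSeq_kerT_middle (d : Fin (m + 1) → ℝ) (c : Fin m) :
    colSeq (kerT m d) (m + c) = Pi.single c 1 := by
  ext r
  rw [colSeq_apply _ (by omega)]
  have : (⟨m + c, by omega⟩ : Fin (m + m + m)) = Fin.castAdd m (Fin.natAdd m c) := rfl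
  rw [this]
  simp [-Fin.natAdd_eq_addNat, kerT, Matrix.one_apply, Pi.single_apply]

theorem kerT_recurrence {d : Fin (m + 1) → ℝ} (h₀ : d 0 ≠ 0) (h₁ : d (Fin.last m) ≠ 0)
    {j : ℕ} (hj : j < m + m) :
    ∑ k : Fin (m + 1), d k • colSeq (kerT m d) (j + k) = 0 := by
  ext r
  rw [← sum_mul_bandEntry _ _ (by omega)]
  have h := congrFun₂ (kerT_mul_kMat_self h₀ h₁) r ⟨j, hj⟩
  simp only [Matrix.mul_apply, kMat_apply] at h
  exact h

/-- The matrix shifting the columns of `kerT` by one. -/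
def shiftMat (d : Fin (m + 1) → ℝ) : Matrix (Fin m) (Fin m) ℝ :=
  fun r c => colSeq (kerT m d) (m + c + 1) r

theorem shiftMat_mulVec_colSeq {d : Fin (m + 1) → ℝ} (h₀ : d 0 ≠ 0) (h₁ : d (Fin.last m) ≠ 0)
    {k : ℕ} (hk : k + 1 < m + m + m) :
    shiftMat d *ᵥ colSeq (kerT m d) k = colSeq (kerT m d) (k + 1) := by
  have base : ∀ c < m, shiftMat d *ᵥ colSeq (kerT m d) (m + c)
      = colSeq (kerT m d) (m + c + 1) := by
    intro c hc
    have := colSeq_kerT_middle d ⟨c, hc⟩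
    dsimp only at this
    rw [this, mulVec_single_one]
    rfl
  have hrec : ∀ j, j + 1 < m + m → ∑ k : Fin (m + 1), d k •
      (shiftMat d *ᵥ colSeq (kerT m d) (j + k) - colSeq (kerT m d) (j + k + 1)) = 0 := by
    intro j hj
    have e₁ := congrArg (fun v => shiftMat d *ᵥ v) (kerT_recurrence h₀ h₁ (j := j) (by omega))
    have e₂ := kerT_recurrence h₀ h₁ hj
    simp only [mulVec_sum, mulVec_smul, mulVec_zero] at e₁
    simp only [smul_sub, Finset.sum_sub_distrib, e₁, zero_sub, neg_eq_zero]
    simpa only [add_right_comm] using e₂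
  rcases le_total m k with hmk | hmk
  · obtain ⟨k, rfl⟩ := Nat.exists_eq_add_of_le hmk
    refine sub_eq_zero.mp (eq_zero_of_recurrence (L := m - 1) h₁
      (u := fun k => shiftMat d *ᵥ colSeq (kerT m d) (m + k) - colSeq (kerT m d) (m + k + 1))
      (fun c hc => sub_eq_zero.mpr (base c hc)) (fun j hj => ?_) k (by omega))
    simpa only [add_assoc] using hrec (m + j) (by omega)
  · have key := eq_zero_of_recurrence (L := m) (d := d ∘ Fin.rev) (by simpa using h₀)
      (u := fun k => shiftMat d *ᵥ colSeq (kerT m d) (m + m - 1 - k)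
        - colSeq (kerT m d) (m + m - 1 - k + 1))
      (fun c hc => ?_) (fun j hj => ?_) (m + m - 1 - k) (by omega)
    · have e : m + m - 1 - (m + m - 1 - k) = k := by omega
      simpa only [e, sub_eq_zero] using key
    · have e : m + m - 1 - c = m + (m - 1 - c) := by omega
      simp only [e]
      exact sub_eq_zero.mpr (base _ (by omega))
    · rw [← Equiv.sum_comp Fin.revPerm, ← hrec (m - 1 - j) (by omega)]
      refine Finset.sum_congr rfl fun k _ => ?_
      have e : m + m - 1 - (j + (Fin.rev k : ℕ)) = m - 1 - j + k := by
        rw [Fin.val_rev]; omega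
      simp only [Function.comp_apply, Fin.revPerm_apply, Fin.rev_rev, e]

theorem shiftMat_pow_mulVec_colSeq {d : Fin (m + 1) → ℝ} (h₀ : d 0 ≠ 0)
    (h₁ : d (Fin.last m) ≠ 0) (i : ℕ) {j : ℕ} (hij : i + j < m + m + m) :
    shiftMat d ^ i *ᵥ colSeq (kerT m d) j = colSeq (kerT m d) (i + j) := by
  induction i with
  | zero => simp
  | succ i ih =>
    rw [pow_succ', ← mulVec_mulVec, ih (by omega), shiftMat_mulVec_colSeq h₀ h₁ (by omega)]
    congr 1
    omega

theorem lastRows_inv_sum {d n : Fin (m + 1) → ℝ} (hS : IsUnit (sylv m d n)) (r : Fin m)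
    (j : Fin (m + m)) :
    ∑ l, lastRows m (sylv m d n)⁻¹ r l * sylv m d n l j
      = (1 : Matrix (Fin (m + m)) (Fin (m + m)) ℝ) (Fin.natAdd m r) j := by
  rw [← nonsing_inv_mul _ ((isUnit_iff_isUnit_det _).mp hS), Matrix.mul_apply]
  rfl

theorem lastRows_inv_recurrence {d n : Fin (m + 1) → ℝ} (hS : IsUnit (sylv m d n))
    {j : ℕ} (hj : j < m) :
    ∑ k : Fin (m + 1), d k • colSeq (lastRows m (sylv m d n)⁻¹) (j + k) = 0 := by
  ext r
  rw [← sum_mul_bandEntry _ _ (by omega)]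
  have h := lastRows_inv_sum hS r (Fin.castAdd m ⟨j, hj⟩)
  simp only [sylv_apply_left] at h
  rw [h, Matrix.one_apply_ne]
  · rfl
  · simp [Fin.ext_iff]
    omega

theorem lastRows_inv_sum_smul {d n : Fin (m + 1) → ℝ} (hS : IsUnit (sylv m d n)) (j : Fin m) :
    ∑ k : Fin (m + 1), n k • colSeq (lastRows m (sylv m d n)⁻¹) (j + k) = Pi.single j 1 := by
  ext r
  rw [← sum_mul_bandEntry _ _ (by omega)]
  have h := lastRows_inv_sum hS r (Fin.natAdd m j)
  simp only [sylv_apply_right] at h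
  rw [h]
  simp [Matrix.one_apply, Pi.single_apply]

end Blocks

theorem bSub_mul_H (m : ℕ) (hm : 1 ≤ m) (d n : Fin (m + 1) → ℝ) (hd : ∀ k, d k ≠ 0) (hn : ∀ k, n k ≠ 0)
    (hS : IsUnit (sylv m d n)) :
    ∀ i : Fin (m + 1),
      subCols m (lastRows m (sylv m d n)⁻¹) i * (kerT m d * kMat m n) = tSub m d i := by
  have h₀ := hd 0
  have h₁ := hd (Fin.last m)
  set B := lastRows m (sylv m d n)⁻¹
  set t := colSeq (kerT m d) with ht
  set A := shiftMat d
  set P := ∑ k : Fin (m + 1), n k • A ^ (k : ℕ) with hP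
  have sub_single (i : Fin (m + 1)) (c : Fin m) :
      subCols m B i *ᵥ t (m + c) = colSeq B (i + c) := by
    rw [ht, colSeq_kerT_middle, mulVec_single_one]
    ext r
    rw [colSeq_apply _ (by omega)]
    rfl
  have P_t {j : ℕ} (hj : j < m + m) : P *ᵥ t j = ∑ k : Fin (m + 1), n k • t (j + k) := by
    rw [hP, sum_mulVec]
    refine Finset.sum_congr rfl fun k _ => ?_
    rw [smul_mulVec, shiftMat_pow_mulVec_colSeq h₀ h₁ _ (by omega), add_comm (k : ℕ)]
  have sub_t {k : ℕ} (hk : k < m + m) : subCols m B 0 *ᵥ t (m + k) = colSeq B k := by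
    refine sub_eq_zero.mp (eq_zero_of_recurrence (L := m) h₁
      (u := fun k => subCols m B 0 *ᵥ t (m + k) - colSeq B k)
      (fun c hc => ?_) (fun j hj => ?_) k hk)
    · simpa [sub_eq_zero] using sub_single 0 ⟨c, hc⟩
    · have e := congrArg (fun v => subCols m B 0 *ᵥ v) (kerT_recurrence h₀ h₁ (j := m + j) (by omega))
      simp only [mulVec_sum, mulVec_smul, mulVec_zero, add_assoc] at e
      simp only [smul_sub, Finset.sum_sub_distrib, ht, e, zero_sub, neg_eq_zero]
      exact lastRows_inv_recurrence hS hj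
  have ext_t {X Y : Matrix (Fin m) (Fin m) ℝ}
      (h : ∀ c : Fin m, X *ᵥ t (m + c) = Y *ᵥ t (m + c)) : X = Y := by
    refine Matrix.ext_of_mulVec_single fun c => ?_
    simpa only [ht, colSeq_kerT_middle] using h c
  have sub_P : subCols m B 0 * P = 1 := by
    refine ext_t fun c => ?_
    rw [← mulVec_mulVec, P_t (by omega), mulVec_sum, one_mulVec, ht, colSeq_kerT_middle,
      ← lastRows_inv_sum_smul hS]
    refine Finset.sum_congr rfl fun k _ => ?_
    rw [mulVec_smul, ← ht, add_assoc m, sub_t (by omega)]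
  have A_P : ∀ i : ℕ, A ^ i * P = P * A ^ i := fun i => by
    simp only [hP, Finset.mul_sum, Finset.sum_mul, mul_smul_comm, smul_mul_assoc, ← pow_add,
      add_comm]
  intro i
  have sub_eq : subCols m B i = subCols m B 0 * A ^ (i : ℕ) := by
    refine ext_t fun c => ?_
    rw [sub_single, ← mulVec_mulVec, shiftMat_pow_mulVec_colSeq h₀ h₁ _ (by omega), ← ht,
      add_left_comm, sub_t (by omega)]
  ext r j
  have hcol : (fun c => (kerT m d * kMat m n) c j) = P *ᵥ t j := by
    rw [P_t j.2]
    ext c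
    simp only [Matrix.mul_apply, kMat_apply]
    exact sum_mul_bandEntry _ _ (by omega) c
  have hprod : subCols m B i *ᵥ (P *ᵥ t j) = t (i + j) := by
    rw [mulVec_mulVec, sub_eq, Matrix.mul_assoc, A_P, ← Matrix.mul_assoc, sub_P, Matrix.one_mul,
      shiftMat_pow_mulVec_colSeq h₀ h₁ _ (by omega)]
  rw [← hcol] at hprod
  refine (congrFun hprod r).trans ?_
  exact colSeq_apply _ (by omega) r
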